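/- (Theorem 1, recurrent representatives.) Let C > 0 and let S ⊆ ℤ × ℤ be a C-net. Call F a toppling function for a bounded χ : ℤ × ℤ → ℤ vanishing on S if F : ℤ × ℤ → ℤ is bounded, F ≥ 0, F vanishes on S, and χ(z) + ΔF(z) ≤ 3 for all z ∉ S; the relaxation χ° is χ + ΔF₀ (restricted to vanish on S) where F₀ is the pointwise minimal toppling function for χ. Call a function ψ recurrent if ψ = χ° for some bounded χ : ℤ × ℤ → ℤ vanishing on S with χ(z) ≥ 3 for all z ∉ S. Then for every bounded φ : ℤ × ℤ → ℤ vanishing on S there exists exactly one recurrent ψ such that ψ − φ lies in the image of the map L defined by (Lg)(z) = Δg(z) for z ∉ S and (Lg)(s) = 0 for s ∈ S, as g ranges over bounded integer-valued functions vanishing on S. -/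

import Mathlib

/-- Discrete Laplacian on `ℤ × ℤ` with values in an additive abelian group. -/
def lap {A : Type*} [AddCommGroup A] (φ : ℤ × ℤ → A) (z : ℤ × ℤ) : A :=
  φ (z.1 + 1, z.2) + φ (z.1 - 1, z.2) + φ (z.1, z.2 + 1) + φ (z.1, z.2 - 1) - (4 : ℤ) • φ z

/-- `S ⊆ ℤ × ℤ` is a `C`-net: every point is within ℓ¹-distance `C` of `S`. -/
def IsCNet (C : ℝ) (S : Set (ℤ × ℤ)) : Prop :=
  ∀ z : ℤ × ℤ, ∃ s ∈ S, (((z.1 - s.1).natAbs + (z.2 - s.2).natAbs : ℕ) : ℝ) ≤ C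

/-- `f` is bounded. -/
def Bdd (f : ℤ × ℤ → ℤ) : Prop := ∃ M : ℤ, ∀ z, |f z| ≤ M

/-- `F` is a toppling function for the state `χ` (with sinks `S`). -/
def IsToppling (S : Set (ℤ × ℤ)) (χ F : ℤ × ℤ → ℤ) : Prop :=
  Bdd F ∧ (∀ z, 0 ≤ F z) ∧ (∀ s ∈ S, F s = 0) ∧ ∀ z ∉ S, χ z + lap F z ≤ 3

open Classical in
/-- The Laplacian restricted away from `S`: it is set to `0` on `S`. -/
noncomputable def restrictLap (S : Set (ℤ × ℤ)) (φ : ℤ × ℤ → ℤ) : ℤ × ℤ → ℤ :=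
  fun z => if z ∈ S then 0 else lap φ z

/-- `ψ` is the relaxation `χ°` of `χ`: `ψ = χ + ΔF₀` (the Laplacian being restricted
to vanish on `S`), where `F₀` is the pointwise minimal toppling function for `χ`. -/
def IsRelaxation (S : Set (ℤ × ℤ)) (χ ψ : ℤ × ℤ → ℤ) : Prop :=
  ∃ F₀ : ℤ × ℤ → ℤ, IsToppling S χ F₀ ∧
    (∀ F : ℤ × ℤ → ℤ, IsToppling S χ F → ∀ z, F₀ z ≤ F z) ∧
    ψ = χ + restrictLap S F₀

/-- `ψ` is recurrent: it is the relaxation of a bounded state, vanishing on `S`,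
which is at least `3` everywhere off `S`. -/
def IsRecurrent (S : Set (ℤ × ℤ)) (ψ : ℤ × ℤ → ℤ) : Prop :=
  ∃ χ : ℤ × ℤ → ℤ, Bdd χ ∧ (∀ s ∈ S, χ s = 0) ∧ (∀ z ∉ S, 3 ≤ χ z) ∧
    IsRelaxation S χ ψ

theorem exists_dist (C : ℝ) (S : Set (ℤ × ℤ)) (hS : IsCNet C S) :
    ∃ (d : ℤ × ℤ → ℕ) (K : ℕ), (∀ z, d z ≤ K) ∧ (∀ s ∈ S, d s = 0) ∧
      ∀ z ∉ S, d (z.1 + 1, z.2) < d z ∨ d (z.1 - 1, z.2) < d z ∨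
        d (z.1, z.2 + 1) < d z ∨ d (z.1, z.2 - 1) < d z := by
  classical
  let P : ℤ × ℤ → ℕ → Prop := fun z n => ∃ s ∈ S, (z.1 - s.1).natAbs + (z.2 - s.2).natAbs = n
  have hP : ∀ z, ∃ n, P z n := fun z => by
    obtain ⟨s, hs, _⟩ := hS z
    exact ⟨_, s, hs, rfl⟩
  have hmin : ∀ z, ∀ s ∈ S, Nat.find (hP z) ≤ (z.1 - s.1).natAbs + (z.2 - s.2).natAbs :=
    fun z s hs => Nat.find_min' (hP z) ⟨s, hs, rfl⟩
  refine ⟨fun z => Nat.find (hP z), ⌊C⌋₊, ?_, ?_, ?_⟩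
  · intro z
    obtain ⟨s, hs, h⟩ := hS z
    exact (hmin z s hs).trans (Nat.le_floor h)
  · intro s hs
    have := hmin s s hs
    simpa using this
  · rintro ⟨a, b⟩ hz
    obtain ⟨⟨p, q⟩, hs, h⟩ := Nat.find_spec (hP (a, b))
    have h1 := hmin (a + 1, b) _ hs
    have h2 := hmin (a - 1, b) _ hs
    have h3 := hmin (a, b + 1) _ hs
    have h4 := hmin (a, b - 1) _ hs
    have hne : a ≠ p ∨ b ≠ q := by
      by_contra hc
      push Not at hc
      exact hz (by rw [hc.1, hc.2]; exact hs)
    simp only at h h1 h2 h3 h4 ⊢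
    omega

theorem lap_int (f : ℤ × ℤ → ℤ) (z : ℤ × ℤ) : lap f z =
    f (z.1 + 1, z.2) + f (z.1 - 1, z.2) + f (z.1, z.2 + 1) + f (z.1, z.2 - 1) - 4 * f z := by
  simp [lap]

theorem exists_super (C : ℝ) (S : Set (ℤ × ℤ)) (hS : IsCNet C S) :
    ∃ W : ℤ × ℤ → ℤ, Bdd W ∧ (∀ z, 0 ≤ W z) ∧ (∀ s ∈ S, W s = 0) ∧
      ∀ z ∉ S, lap W z ≤ -1 := by
  obtain ⟨d, K, hK, h0, hd⟩ := exists_dist C S hS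
  let u : ℤ × ℤ → ℤ := fun z => 4 ^ (K - d z)
  have hu1 : ∀ z, 1 ≤ u z := fun z => one_le_pow₀ (by norm_num)
  have huK : ∀ z, u z ≤ 4 ^ K := fun z => pow_le_pow_right₀ (by norm_num) (Nat.sub_le _ _)
  have hlt : ∀ z w, d w < d z → 4 * u z ≤ u w := fun z w h => by
    have h1 := hK z
    change 4 * 4 ^ (K - d z) ≤ (4 : ℤ) ^ (K - d w)
    rw [← pow_succ']
    exact pow_le_pow_right₀ (by norm_num) (by omega)
  refine ⟨fun z => 4 ^ K - u z, ⟨4 ^ K, fun z => ?_⟩, fun z => ?_, fun s hs => ?_, fun z hz => ?_⟩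
  · have := hu1 z
    have := huK z
    rw [abs_of_nonneg] <;> linarith
  · linarith [huK z]
  · simp [u, h0 s hs]
  · rw [lap_int]
    have h1 := hu1 (z.1 + 1, z.2)
    have h2 := hu1 (z.1 - 1, z.2)
    have h3 := hu1 (z.1, z.2 + 1)
    have h4 := hu1 (z.1, z.2 - 1)
    rcases hd z hz with h | h | h | h <;> have := hlt _ _ h <;> linarith

theorem exists_relax (S : Set (ℤ × ℤ)) (χ F : ℤ × ℤ → ℤ) (hF : IsToppling S χ F) :
    ∃ F₀ : ℤ × ℤ → ℤ, IsToppling S χ F₀ ∧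
      ∀ F : ℤ × ℤ → ℤ, IsToppling S χ F → ∀ z, F₀ z ≤ F z := by
  classical
  have key : ∀ z, ∃ m : ℤ, (∃ G, IsToppling S χ G ∧ G z = m) ∧
      ∀ G, IsToppling S χ G → m ≤ G z := by
    intro z
    obtain ⟨m, hm, hm'⟩ := Int.exists_least_of_bdd (P := fun m => ∃ G, IsToppling S χ G ∧ G z = m)
      ⟨0, by rintro m ⟨G, hG, rfl⟩; exact hG.2.1 z⟩ ⟨F z, F, hF, rfl⟩
    exact ⟨m, hm, fun G hG => hm' _ ⟨G, hG, rfl⟩⟩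
  choose F₀ h1 h2 using key
  have hnn : ∀ z, 0 ≤ F₀ z := fun z => by
    obtain ⟨G, hG, h⟩ := h1 z
    rw [← h]; exact hG.2.1 z
  refine ⟨F₀, ⟨?_, hnn, ?_, ?_⟩, fun G hG z => h2 z G hG⟩
  · obtain ⟨M, hM⟩ := hF.1
    refine ⟨M, fun z => ?_⟩
    rw [abs_of_nonneg (hnn z)]
    exact (h2 z F hF).trans ((le_abs_self _).trans (hM z))
  · intro s hs
    obtain ⟨G, hG, h⟩ := h1 s
    rw [← h]; exact hG.2.2.1 s hs
  · intro z hz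
    obtain ⟨G, hG, h⟩ := h1 z
    have := hG.2.2.2 z hz
    rw [lap_int] at this ⊢
    have a1 := h2 (z.1 + 1, z.2) G hG
    have a2 := h2 (z.1 - 1, z.2) G hG
    have a3 := h2 (z.1, z.2 + 1) G hG
    have a4 := h2 (z.1, z.2 - 1) G hG
    linarith

theorem rec_stable (S : Set (ℤ × ℤ)) (ψ : ℤ × ℤ → ℤ) (h : IsRecurrent S ψ) :
    ∀ z ∉ S, ψ z ≤ 3 := by
  obtain ⟨χ, -, -, -, F, hF, -, rfl⟩ := h
  intro z hz
  simpa [restrictLap, hz] using hF.2.2.2 z hz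

theorem rec_le (C : ℝ) (S : Set (ℤ × ℤ)) (hS : IsCNet C S) (ψ₁ ψ₂ g : ℤ × ℤ → ℤ)
    (h₁ : ∀ z ∉ S, ψ₁ z ≤ 3) (h₂ : IsRecurrent S ψ₂) (hgb : Bdd g) (hg0 : ∀ s ∈ S, g s = 0)
    (hg : ∀ z ∉ S, ψ₂ z = ψ₁ z + lap g z) : ∀ z, g z ≤ 0 := by
  classical
  by_contra hcon
  push Not at hcon
  obtain ⟨z₀, hz₀⟩ := hcon
  obtain ⟨B, hB⟩ := hgb
  obtain ⟨M, ⟨zM, hzM⟩, hM⟩ := Int.exists_greatest_of_bdd (P := fun m => ∃ z, g z = m)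
    ⟨B, by rintro m ⟨z, rfl⟩; exact (le_abs_self _).trans (hB z)⟩ ⟨g z₀, z₀, rfl⟩
  have hM' : ∀ z, g z ≤ M := fun z => hM _ ⟨z, rfl⟩
  have hMpos : 0 < M := hz₀.trans_le (hM' z₀)
  obtain ⟨d, K, hK, h0, hd⟩ := exists_dist C S hS
  have hst := rec_stable S ψ₂ h₂
  obtain ⟨χ, -, -, hχ, F, hF, hmin, hψ⟩ := h₂
  have hψ' : ∀ z ∉ S, ψ₂ z = χ z + lap F z := fun z hz => by simp [hψ, restrictLap, hz]
  let I : ℤ × ℤ → ℤ := fun z => if g z = M then 1 else 0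
  have hI0 : ∀ z, 0 ≤ I z := fun z => by simp only [I]; split_ifs <;> norm_num
  have hIM : ∀ z, g z = M → I z = 1 := fun z h => by simp [I, h]
  have hIN : ∀ z, g z ≠ M → I z = 0 := fun z h => by simp [I, h]
  have hIg : ∀ z, g z ≤ M - 1 + I z := fun z => by
    have := hM' z
    simp only [I]; split_ifs <;> omega
  have hnS : ∀ z, g z = M → z ∉ S := fun z h hs => by
    have := hg0 z hs
    omega
  have hA : ∀ z, g z = M → ψ₂ z - lap I z ≤ 3 := fun z h => by
    have e := hg z (hnS z h)
    have e1 := h₁ z (hnS z h)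
    have a := hIg (z.1 + 1, z.2)
    have a2 := hIg (z.1 - 1, z.2)
    have a3 := hIg (z.1, z.2 + 1)
    have a4 := hIg (z.1, z.2 - 1)
    have a5 := hIM z h
    rw [lap_int] at e ⊢
    linarith
  have hFpos : ∀ n z, d z = n → g z = M → 1 ≤ F z := by
    intro n
    induction n using Nat.strong_induction_on with
    | _ n ih =>
    intro z hn h
    by_contra hF1
    have hFz : F z = 0 := by have := hF.2.1 z; omega
    have hz := hnS z h
    have c1 := hA z h
    have c2 := hψ' z hz
    have c3 := hχ z hz
    have c4 := hIM z h
    rw [lap_int] at c1 c2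
    have step : ∀ w, d w < d z → I w = 1 → F w = 0 → False := fun w hw hi hf => by
      have hwM : g w = M := by
        by_contra hc
        have := hIN w hc
        omega
      have := ih (d w) (hn ▸ hw) w rfl hwM
      omega
    have hI1 : ∀ z, I z ≤ 1 := fun z => by simp only [I]; split_ifs <;> norm_num
    have p1 := hF.2.1 (z.1 + 1, z.2)
    have p2 := hF.2.1 (z.1 - 1, z.2)
    have p3 := hF.2.1 (z.1, z.2 + 1)
    have p4 := hF.2.1 (z.1, z.2 - 1)
    have q1 := hI1 (z.1 + 1, z.2)
    have q2 := hI1 (z.1 - 1, z.2)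
    have q3 := hI1 (z.1, z.2 + 1)
    have q4 := hI1 (z.1, z.2 - 1)
    rcases hd z hz with h | h | h | h <;>
      exact step _ h (by linarith) (by linarith)
  have hlapsub : ∀ z, lap (fun w => F w - I w) z = lap F z - lap I z := fun z => by
    simp only [lap_int]; ring
  have hT : IsToppling S χ (fun z => F z - I z) := by
    refine ⟨?_, ?_, ?_, ?_⟩
    · obtain ⟨Q, hQ⟩ := hF.1
      refine ⟨Q + 1, fun z => ?_⟩
      have := abs_le.1 (hQ z)
      have hI1 : I z ≤ 1 := by simp only [I]; split_ifs <;> norm_num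
      have := hI0 z
      rw [abs_le]; constructor <;> linarith
    · intro z
      by_cases h : g z = M
      · have := hFpos _ z rfl h
        have := hIM z h
        simp only; omega
      · have := hIN z h
        have := hF.2.1 z
        simp only; omega
    · intro s hs
      have := hIN s (fun h => hnS s h hs)
      simp [this, hF.2.2.1 s hs]
    · intro z hz
      rw [hlapsub]
      have e := hψ' z hz
      by_cases h : g z = M
      · linarith [hA z h]
      · have := hst z hz
        have e2 := hIN z h
        have : 0 ≤ lap I z := by
          rw [lap_int]
          linarith [hI0 (z.1 + 1, z.2), hI0 (z.1 - 1, z.2), hI0 (z.1, z.2 + 1),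
            hI0 (z.1, z.2 - 1)]
        linarith
  have := hmin _ hT zM
  have := hIM zM hzM
  omega

theorem stmt16 (C : ℝ) (hC : 0 < C) (S : Set (ℤ × ℤ)) (hS : IsCNet C S)
    (φ : ℤ × ℤ → ℤ) (hφb : Bdd φ) (hφ0 : ∀ s ∈ S, φ s = 0) :
    ∃! ψ : ℤ × ℤ → ℤ, IsRecurrent S ψ ∧
      ∃ g : ℤ × ℤ → ℤ, Bdd g ∧ (∀ s ∈ S, g s = 0) ∧ ψ = φ + restrictLap S g := by
  classical
  obtain ⟨W, ⟨Q, hQ⟩, hW0, hWS, hW⟩ := exists_super C S hS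
  obtain ⟨B, hB⟩ := hφb
  have hB0 : 0 ≤ B := (abs_nonneg _).trans (hB 0)
  have hQ0 : 0 ≤ Q := (abs_nonneg _).trans (hQ 0)
  have hsub : ∀ (f g : ℤ × ℤ → ℤ) z, lap (fun w => f w - g w) z = lap f z - lap g z :=
    fun f g z => by simp only [lap_int]; ring
  have hmul : ∀ (n : ℤ) (g : ℤ × ℤ → ℤ) z, lap (fun w => n * g w) z = n * lap g z :=
    fun f g z => by simp only [lap_int]; ring
  apply existsUnique_of_exists_of_unique
  · let N : ℤ := B + 3
    let χ : ℤ × ℤ → ℤ := fun z => φ z - N * restrictLap S W z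
    have hlapb : ∀ z, |lap W z| ≤ 8 * Q := fun z => by
      rw [lap_int, abs_le]
      have := abs_le.1 (hQ (z.1 + 1, z.2))
      have := abs_le.1 (hQ (z.1 - 1, z.2))
      have := abs_le.1 (hQ (z.1, z.2 + 1))
      have := abs_le.1 (hQ (z.1, z.2 - 1))
      have := abs_le.1 (hQ z)
      constructor <;> linarith
    have hrb : ∀ z, |restrictLap S W z| ≤ 8 * Q := fun z => by
      unfold restrictLap
      split_ifs
      · simp; exact hQ0
      · exact hlapb z
    have hχb : ∀ z, |χ z| ≤ B + N * (8 * Q) := fun z => by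
      refine (abs_sub _ _).trans (add_le_add (hB z) ?_)
      rw [abs_mul, abs_of_nonneg (by omega : 0 ≤ N)]
      exact mul_le_mul_of_nonneg_left (hrb z) (by omega)
    have hχ3 : ∀ z ∉ S, 3 ≤ χ z := fun z hz => by
      have h1 := hW z hz
      have h2 := (abs_le.1 (hB z)).1
      simp only [χ, restrictLap, if_neg hz, N]
      nlinarith
    have hχS : ∀ s ∈ S, χ s = 0 := fun s hs => by simp [χ, restrictLap, hs, hφ0 s hs]
    let R : ℤ := B + N * (8 * Q)
    have hR0 : 0 ≤ R := (abs_nonneg _).trans (hχb 0)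
    have hT : IsToppling S χ (fun z => R * W z) := by
      refine ⟨⟨R * Q, fun z => ?_⟩, fun z => mul_nonneg hR0 (hW0 z), fun s hs => ?_, fun z hz => ?_⟩
      · rw [abs_mul, abs_of_nonneg hR0]
        exact mul_le_mul_of_nonneg_left (hQ z) hR0
      · simp [hWS s hs]
      · rw [hmul]
        have h1 := hW z hz
        have h2 : χ z ≤ R := (abs_le.1 (hχb z)).2
        nlinarith
    obtain ⟨F, hF, hmin⟩ := exists_relax S χ _ hT
    refine ⟨χ + restrictLap S F, ⟨χ, ⟨_, hχb⟩, hχS, hχ3, F, hF, hmin, rfl⟩,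
      fun z => F z - N * W z, ?_, fun s hs => ?_, ?_⟩
    · obtain ⟨P, hP⟩ := hF.1
      refine ⟨P + N * Q, fun z => ?_⟩
      refine (abs_sub _ _).trans (add_le_add (hP z) ?_)
      rw [abs_mul, abs_of_nonneg (by omega : 0 ≤ N)]
      exact mul_le_mul_of_nonneg_left (hQ z) (by omega)
    · simp [hF.2.2.1 s hs, hWS s hs]
    · funext z
      by_cases hz : z ∈ S
      · simp [χ, restrictLap, hz]
      · simp only [χ, restrictLap, hz, Pi.add_apply, if_false, hsub, hmul]
        ring
  · rintro ψ₁ ψ₂ ⟨hr1, g₁, ⟨B1, hb1⟩, hz1, e1⟩ ⟨hr2, g₂, ⟨B2, hb2⟩, hz2, e2⟩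
    have s1 := rec_stable S _ hr1
    have s2 := rec_stable S _ hr2
    have l1 := rec_le C S hS ψ₁ ψ₂ (fun z => g₂ z - g₁ z) s1 hr2
      ⟨B2 + B1, fun z => (abs_sub _ _).trans (add_le_add (hb2 z) (hb1 z))⟩
      (fun s hs => by simp [hz1 s hs, hz2 s hs])
      (fun z hz => by simp [e1, e2, restrictLap, hz, hsub])
    have l2 := rec_le C S hS ψ₂ ψ₁ (fun z => g₁ z - g₂ z) s2 hr1
      ⟨B1 + B2, fun z => (abs_sub _ _).trans (add_le_add (hb1 z) (hb2 z))⟩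
      (fun s hs => by simp [hz1 s hs, hz2 s hs])
      (fun z hz => by simp [e1, e2, restrictLap, hz, hsub])
    have : g₁ = g₂ := by
      funext z
      have a := l1 z
      have b := l2 z
      omega
    rw [e1, e2, this]
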